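/- Let H : Rᵒᵖ × S ⥤ Type be a profunctor, C a category, ρ : C ⥤ R and σ : C ⥤ S functors, and λ = (λ_c)_{c ∈ C} a natural family of heteromorphisms λ_c ∈ H(ρ c, σ c). If λ_c is a limit of σ c in H for each object c of C, then λ is a limit of σ in the power profunctor H^C; that is, for every functor ρ' : C ⥤ R, the map sending a natural transformation α : ρ' ⟶ ρ to the family ((α_c)^*(λ_c))_{c ∈ C} is a bijection from natural transformations ρ' ⟶ ρ onto the set of natural families of heteromorphisms in H(ρ' c, σ c). -/

import Mathlib

open CategoryTheory Opposite

universe w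

/-- Pullback of a heteromorphism `h ∈ H(r,s)` along an arrow `a : r' ⟶ r`. -/
def pullb {R S : Type*} [Category R] [Category S] (H : Rᵒᵖ × S ⥤ Type w)
    {r r' : R} {s : S} (a : r' ⟶ r) (h : H.obj (op r, s)) : H.obj (op r', s) :=
  H.map ((a.op, 𝟙 s) : ((op r, s) : Rᵒᵖ × S) ⟶ (op r', s)) h

/-- Pushforward of a heteromorphism `h ∈ H(r,s)` along an arrow `b : s ⟶ s'`. -/
def pushf {R S : Type*} [Category R] [Category S] (H : Rᵒᵖ × S ⥤ Type w)
    {r : R} {s s' : S} (b : s ⟶ s') (h : H.obj (op r, s)) : H.obj (op r, s') :=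
  H.map ((𝟙 (op r), b) : ((op r, s) : Rᵒᵖ × S) ⟶ (op r, s')) h

/-- A heteromorphism `h ∈ H(r,s)` is a limit of `s` if pulling it back is a bijection
`Hom(r',r) ≃ H(r',s)` for every `r'`. -/
def IsLimitHet {R S : Type*} [Category R] [Category S] (H : Rᵒᵖ × S ⥤ Type w)
    {r : R} {s : S} (h : H.obj (op r, s)) : Prop :=
  ∀ r' : R, Function.Bijective fun a : r' ⟶ r => pullb H a h

/-- A family of heteromorphisms `η_c ∈ H(ρ c, σ c)` is natural if
`(σ a)_*(η_c) = (ρ a)^*(η_{c'})` for every arrow `a : c ⟶ c'`. These families are the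
elements `H^C(ρ,σ)` of the power profunctor `H^C`. -/
def NatFam {R S C : Type*} [Category R] [Category S] [Category C]
    (H : Rᵒᵖ × S ⥤ Type w) (ρ : C ⥤ R) (σ : C ⥤ S)
    (η : ∀ c : C, H.obj (op (ρ.obj c), σ.obj c)) : Prop :=
  ∀ {c c' : C} (a : c ⟶ c'), pushf H (σ.map a) (η c) = pullb H (ρ.map a) (η c')

section

variable {R S : Type*} [Category R] [Category S] (H : Rᵒᵖ × S ⥤ Type w)

lemma pullb_comp {r r' r'' : R} {s : S} (a : r'' ⟶ r') (b : r' ⟶ r) (h : H.obj (op r, s)) :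
    pullb H (a ≫ b) h = pullb H a (pullb H b h) := by
  simp only [pullb, ← Functor.map_comp_apply, prod_comp, op_comp, Category.comp_id]

lemma pushf_pullb {r r' : R} {s s' : S} (a : r' ⟶ r) (b : s ⟶ s') (h : H.obj (op r, s)) :
    pushf H b (pullb H a h) = pullb H a (pushf H b h) := by
  simp only [pullb, pushf, ← Functor.map_comp_apply, prod_comp, Category.comp_id,
    Category.id_comp]

end

/-- If `λ` is a natural family such that each `λ_c` is a limit of `σ c` in `H`, then `λ` is
a limit of `σ` in the power profunctor `H^C`: for every `ρ' : C ⥤ R`, the map sending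
`α : ρ' ⟶ ρ` to the family `((α_c)^*(λ_c))_c` is a bijection onto the set of natural
families of heteromorphisms in `H(ρ' c, σ c)`. -/
theorem stmt8 {R S C : Type*} [Category R] [Category S] [Category C]
    (H : Rᵒᵖ × S ⥤ Type w) (ρ : C ⥤ R) (σ : C ⥤ S)
    (lam : ∀ c : C, H.obj (op (ρ.obj c), σ.obj c))
    (hnat : NatFam H ρ σ lam)
    (hlim : ∀ c : C, IsLimitHet H (lam c)) :
    ∀ ρ' : C ⥤ R,
      Function.Injective (fun α : ρ' ⟶ ρ => fun c : C => pullb H (α.app c) (lam c)) ∧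
      Set.range (fun α : ρ' ⟶ ρ => fun c : C => pullb H (α.app c) (lam c)) =
        {η : ∀ c : C, H.obj (op (ρ'.obj c), σ.obj c) | NatFam H ρ' σ η} := by
  intro ρ'
  refine ⟨fun α β h => ?_, Set.Subset.antisymm ?_ fun η hη => ?_⟩
  · ext c
    exact (hlim c _).1 (congrFun h c)
  · rintro _ ⟨α, rfl⟩ c c' a
    rw [pushf_pullb, hnat a, ← pullb_comp, ← pullb_comp, α.naturality]
  · choose α hα using fun c => (hlim c (ρ'.obj c)).2 (η c)
    refine ⟨⟨α, fun c c' a => (hlim c' _).1 ?_⟩, funext hα⟩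
    dsimp only at hα ⊢
    rw [pullb_comp, hα, ← hη a, ← hα, pushf_pullb, hnat a, ← pullb_comp]
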